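/- Let n ≥ 1 and let Ω ⊂ ℍⁿ be a bounded open set. Let α, β, γ ∈ C^{0,1}_loc(ℝ) be such that β(s) > β₀ > 0 for some constant β₀, γ ≥ 0, α is non-decreasing, and β and γ are non-increasing. Then the function L(ξ,s,p) := α(s) p⊗p − γ(s) Jp⊗Jp − β(s)|p|² I₂ₙ satisfies the structural conditions (3.3), (3.4) and (3.5) (listed in the context) with exponent m = 2; that is: (3.3) for every R > 0 there exists C > 0 with |∇_ξ L(ξ,s,p)| ≤ C|p|² and |∇_p L(ξ,s,p)| ≤ C|p| for all ξ ∈ Ω, |s| ≤ R, p ∈ ℝ²ⁿ; (3.4) for every R > 0 there exists C > 0 with 0 ≤ L(ξ,s′,p) − L(ξ,s,p) ≤ C(s′−s)|p|² I₂ₙ for all −R ≤ s ≤ s′ ≤ R; and (3.5) for every R > 0 and Λ > 0 there exist θ̄ > 0 and C > 0 such that p·∇_p L(ξ,s,p) − L(ξ,s,p) + θΛ|∇_p L(ξ,s,p)| I₂ₙ − θ I₂ₙ ≤ C p⊗p − (1/C)|p|² I₂ₙ for all θ ∈ [0,θ̄], ξ ∈ Ω, |s| ≤ R, p ∈ ℝ²ⁿ.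 -/

import Mathlib

open Filter Topology Matrix Asymptotics

noncomputable section

/-- Points of the Heisenberg group `ℍⁿ`: `(x, y, t) ∈ ℝⁿ × ℝⁿ × ℝ`. -/
abbrev Heis (n : ℕ) : Type := (Fin n → ℝ) × (Fin n → ℝ) × ℝ

/-- Index type for the `2n` horizontal directions. -/
abbrev HIdx (n : ℕ) : Type := Fin n ⊕ Fin n

/-- `2n × 2n` real matrices. -/
abbrev HMat (n : ℕ) : Type := Matrix (HIdx n) (HIdx n) ℝ

namespace Heis

variable {n : ℕ}

/-- The Heisenberg group law. -/
def hmul (ξ η : Heis n) : Heis n :=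
  (ξ.1 + η.1, ξ.2.1 + η.2.1,
    ξ.2.2 + η.2.2 + 2 * ∑ i, (ξ.2.1 i * η.1 i - ξ.1 i * η.2.1 i))

/-- The group inverse `ξ⁻¹ = -ξ`. -/
def hinv (ξ : Heis n) : Heis n := (-ξ.1, -ξ.2.1, -ξ.2.2)

/-- `|z|²` for `ξ = (z, t)`. -/
def zsq (ξ : Heis n) : ℝ := ∑ i, (ξ.1 i ^ 2 + ξ.2.1 i ^ 2)

/-- The homogeneous norm `|ξ|_H = (|z|⁴ + t²)^{1/4}`. -/
def hnorm (ξ : Heis n) : ℝ := (zsq ξ ^ 2 + ξ.2.2 ^ 2) ^ ((1 : ℝ) / 4)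

/-- The left-invariant horizontal vector fields `X_j` (for `Sum.inl j`)
and `Y_j` (for `Sum.inr j`), as tangent vectors at `ξ`. -/
def vecField (j : HIdx n) (ξ : Heis n) : Heis n :=
  match j with
  | Sum.inl j => (Pi.single j 1, 0, 2 * ξ.2.1 j)
  | Sum.inr j => (0, Pi.single j 1, -(2 * ξ.1 j))

/-- Horizontal (Heisenberg) gradient `∇_H ψ (ξ) ∈ ℝ^{2n}`. -/
def hGrad (ψ : Heis n → ℝ) (ξ : Heis n) : HIdx n → ℝ :=
  fun j => fderiv ℝ ψ ξ (vecField j ξ)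

/-- Heisenberg Hessian: entry `(i, j)` is `(field j)((field i) ψ)(ξ)`. -/
def hHess (ψ : Heis n → ℝ) (ξ : Heis n) : HMat n :=
  Matrix.of fun i j =>
    fderiv ℝ (fun η => fderiv ℝ ψ η (vecField i η)) ξ (vecField j ξ)

/-- Symmetrized Heisenberg Hessian `∇²_{H,s} ψ`. -/
def hHessSym (ψ : Heis n → ℝ) (ξ : Heis n) : HMat n :=
  ((1 : ℝ) / 2) • (hHess ψ ξ + (hHess ψ ξ)ᵀ)

/-- The standard symplectic matrix `J = [[0, Iₙ], [-Iₙ, 0]]`. -/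
def Jmat (n : ℕ) : HMat n :=
  Matrix.of fun i j =>
    match i, j with
    | Sum.inl a, Sum.inr b => if a = b then (1 : ℝ) else 0
    | Sum.inr a, Sum.inl b => if a = b then (-1 : ℝ) else 0
    | _, _ => 0

/-- Euclidean norm of `p ∈ ℝ^{2n}`. -/
def pnorm (p : HIdx n → ℝ) : ℝ := Real.sqrt (∑ j, p j ^ 2)

/-- The Loewner (positive semidefinite) order on matrices. -/
def matLE (A B : HMat n) : Prop := (B - A).PosSemidef

/-- The operator `F[ψ] = ∇²_{H,s} ψ + L(·, ψ, ∇_H ψ)`. -/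
def Fop (L : Heis n → ℝ → (HIdx n → ℝ) → HMat n) (ψ : Heis n → ℝ) (ξ : Heis n) : HMat n :=
  hHessSym ψ ξ + L ξ (ψ ξ) (hGrad ψ ξ)

/-- Viscosity subsolution of `F[ψ] ∈ ∂Σ` in `Ω`: `F[ψ] ∈ closure Σ`
in the viscosity sense. -/
def IsSubsolution (Ω : Set (Heis n)) (L : Heis n → ℝ → (HIdx n → ℝ) → HMat n)
    (S : Set (HMat n)) (v : Heis n → EReal) : Prop :=
  ∀ ξ₀ ∈ Ω, ∀ φ : Heis n → ℝ, ContDiffOn ℝ 2 φ Ω → v ξ₀ = ((φ ξ₀ : ℝ) : EReal) →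
    (∀ᶠ η in nhds ξ₀, η ∈ Ω → v η ≤ ((φ η : ℝ) : EReal)) →
    Fop L φ ξ₀ ∈ closure S

/-- Viscosity supersolution of `F[ψ] ∈ ∂Σ` in `Ω`: `F[ψ] ∈ S^{2n×2n} ∖ Σ`
in the viscosity sense. -/
def IsSupersolution (Ω : Set (Heis n)) (L : Heis n → ℝ → (HIdx n → ℝ) → HMat n)
    (S : Set (HMat n)) (w : Heis n → EReal) : Prop :=
  ∀ ξ₀ ∈ Ω, ∀ φ : Heis n → ℝ, ContDiffOn ℝ 2 φ Ω → w ξ₀ = ((φ ξ₀ : ℝ) : EReal) →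
    (∀ᶠ η in nhds ξ₀, η ∈ Ω → ((φ η : ℝ) : EReal) ≤ w η) →
    Fop L φ ξ₀ ∉ S

/-- The class `USC(s)`: upper semicontinuous, valued in `ℝ ∪ {-∞}`, not identically `-∞`. -/
def USCFun (s : Set (Heis n)) (v : Heis n → EReal) : Prop :=
  UpperSemicontinuousOn v s ∧ (∀ ξ ∈ s, v ξ ≠ ⊤) ∧ (∃ ξ ∈ s, v ξ ≠ ⊥)

/-- The class `LSC(s)`: lower semicontinuous, valued in `ℝ ∪ {+∞}`, not identically `+∞`. -/
def LSCFun (s : Set (Heis n)) (w : Heis n → EReal) : Prop :=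
  LowerSemicontinuousOn w s ∧ (∀ ξ ∈ s, w ξ ≠ ⊥) ∧ (∃ ξ ∈ s, w ξ ≠ ⊤)

/-- `Σ` is (relatively) open as a subset of the space of symmetric matrices. -/
def RelOpen (S : Set (HMat n)) : Prop :=
  IsOpen {A : {M : HMat n // M.IsSymm} | A.1 ∈ S}

/-- The quadratic lower-order term
`L(ξ,s,p) = α(ξ,s) p⊗p - γ(ξ,s) Jp⊗Jp - β(ξ,s)|p|² I₂ₙ`. -/
def Lquad (α β γ : Heis n → ℝ → ℝ) : Heis n → ℝ → (HIdx n → ℝ) → HMat n :=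
  fun ξ s p =>
    α ξ s • vecMulVec p p - γ ξ s • vecMulVec (Jmat n *ᵥ p) (Jmat n *ᵥ p)
      - (β ξ s * ∑ j, p j ^ 2) • (1 : HMat n)

/-- The quadratic lower-order term with constant coefficients
`L(s,p) = a p⊗p - c Jp⊗Jp - b|p|² I₂ₙ`. -/
def LquadC (a b c : ℝ) : Heis n → ℝ → (HIdx n → ℝ) → HMat n :=
  fun _ _ p =>
    a • vecMulVec p p - c • vecMulVec (Jmat n *ᵥ p) (Jmat n *ᵥ p)
      - (b * ∑ j, p j ^ 2) • (1 : HMat n)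

/-- Locally Lipschitz on a set. -/
def LocallyLipschitzOnSet {X : Type*} [PseudoMetricSpace X] (s : Set X) (f : X → ℝ) : Prop :=
  ∀ x ∈ s, ∃ K : NNReal, ∃ t ∈ nhdsWithin x s, LipschitzOnWith K f t

/-- All entries of `L(ξ,s,·)` are differentiable at `p`. -/
def DiffInP (L : Heis n → ℝ → (HIdx n → ℝ) → HMat n) (ξ : Heis n) (s : ℝ)
    (p : HIdx n → ℝ) : Prop :=
  ∀ i j, DifferentiableAt ℝ (fun q => L ξ s q i j) p

/-- All entries of `L(·,s,p)` are differentiable at `ξ`. -/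
def DiffInXi (L : Heis n → ℝ → (HIdx n → ℝ) → HMat n) (ξ : Heis n) (s : ℝ)
    (p : HIdx n → ℝ) : Prop :=
  ∀ i j, DifferentiableAt ℝ (fun η => L η s p i j) ξ

/-- A norm of `∇_p L(ξ,s,p)`. -/
def pGradNorm (L : Heis n → ℝ → (HIdx n → ℝ) → HMat n) (ξ : Heis n) (s : ℝ)
    (p : HIdx n → ℝ) : ℝ :=
  Real.sqrt (∑ i, ∑ j, ∑ k, (fderiv ℝ (fun q => L ξ s q i j) p (Pi.single k 1)) ^ 2)

/-- A norm of `∇_ξ L(ξ,s,p)`. -/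
def xiGradNorm (L : Heis n → ℝ → (HIdx n → ℝ) → HMat n) (ξ : Heis n) (s : ℝ)
    (p : HIdx n → ℝ) : ℝ :=
  Real.sqrt (∑ i : HIdx n, ∑ j : HIdx n, ‖fderiv ℝ (fun η => L η s p i j) ξ‖ ^ 2)

/-- The matrix `p · ∇_p L(ξ,s,p)`. -/
def pDotGradL (L : Heis n → ℝ → (HIdx n → ℝ) → HMat n) (ξ : Heis n) (s : ℝ)
    (p : HIdx n → ℝ) : HMat n :=
  Matrix.of fun i j => fderiv ℝ (fun q => L ξ s q i j) p p

/-- Structural condition (3.3): `|∇_ξ L(ξ,s,p)| ≤ C|p|^m` and `|∇_p L(ξ,s,p)| ≤ C|p|`. -/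
def Cond33 (Ω : Set (Heis n)) (L : Heis n → ℝ → (HIdx n → ℝ) → HMat n) (m : ℝ) : Prop :=
  ∀ R : ℝ, 0 < R → ∃ C : ℝ, 0 < C ∧ ∀ ξ ∈ Ω, ∀ s : ℝ, |s| ≤ R → ∀ p : HIdx n → ℝ,
    (DiffInXi L ξ s p → xiGradNorm L ξ s p ≤ C * pnorm p ^ m) ∧
    (DiffInP L ξ s p → pGradNorm L ξ s p ≤ C * pnorm p)

/-- Structural condition (3.4): `0 ≤ L(ξ,s',p) - L(ξ,s,p) ≤ C(s'-s)|p|^m I₂ₙ`. -/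
def Cond34 (Ω : Set (Heis n)) (L : Heis n → ℝ → (HIdx n → ℝ) → HMat n) (m : ℝ) : Prop :=
  ∀ R : ℝ, 0 < R → ∃ C : ℝ, 0 < C ∧ ∀ ξ ∈ Ω, ∀ s s' : ℝ, -R ≤ s → s ≤ s' → s' ≤ R →
    ∀ p : HIdx n → ℝ,
      matLE 0 (L ξ s' p - L ξ s p) ∧
      matLE (L ξ s' p - L ξ s p) ((C * (s' - s) * pnorm p ^ m) • (1 : HMat n))

/-- The second inequality of condition (3.4): `L(ξ,s',p) - L(ξ,s,p) ≤ C(s'-s)|p|^m I₂ₙ`. -/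
def Cond34Upper (Ω : Set (Heis n)) (L : Heis n → ℝ → (HIdx n → ℝ) → HMat n) (m : ℝ) : Prop :=
  ∀ R : ℝ, 0 < R → ∃ C : ℝ, 0 < C ∧ ∀ ξ ∈ Ω, ∀ s s' : ℝ, -R ≤ s → s ≤ s' → s' ≤ R →
    ∀ p : HIdx n → ℝ,
      matLE (L ξ s' p - L ξ s p) ((C * (s' - s) * pnorm p ^ m) • (1 : HMat n))

/-- Structural condition (3.5). -/
def Cond35 (Ω : Set (Heis n)) (L : Heis n → ℝ → (HIdx n → ℝ) → HMat n) (m : ℝ) : Prop :=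
  ∀ R : ℝ, 0 < R → ∀ Λ : ℝ, 0 < Λ → ∃ θb : ℝ, 0 < θb ∧ ∃ C : ℝ, 0 < C ∧
    ∀ θ : ℝ, 0 ≤ θ → θ ≤ θb → ∀ ξ ∈ Ω, ∀ s : ℝ, |s| ≤ R → ∀ p : HIdx n → ℝ,
      DiffInP L ξ s p →
      matLE (pDotGradL L ξ s p - L ξ s p + (θ * Λ * pGradNorm L ξ s p) • (1 : HMat n)
              - θ • (1 : HMat n))
            (C • vecMulVec p p - ((1 / C) * pnorm p ^ m) • (1 : HMat n))

/-- Structural condition (3.7). -/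
def Cond37 (Ω : Set (Heis n)) (L : Heis n → ℝ → (HIdx n → ℝ) → HMat n) (m : ℝ) : Prop :=
  ∀ R : ℝ, 0 < R → ∀ Λ : ℝ, 0 < Λ → ∃ θb : ℝ, 0 < θb ∧ ∃ C : ℝ, 0 < C ∧
    ∀ θ : ℝ, 0 < θ → θ ≤ θb → ∀ ξ ∈ Ω, ∀ s : ℝ, |s| ≤ R → ∀ p : HIdx n → ℝ,
      DiffInP L ξ s p →
      matLE ((-C) • vecMulVec p p + ((1 / C) * pnorm p ^ m) • (1 : HMat n))
            (pDotGradL L ξ s p - L ξ s p - (θ * Λ * pGradNorm L ξ s p) • (1 : HMat n)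
              + θ • (1 : HMat n))

/-- `P` is a second-order Taylor witness for `u` at `ξ`: `u` is punctually second order
differentiable at `ξ` with expansion given by the `C²` function `P`. -/
def PunctualWitness (u P : Heis n → ℝ) (ξ : Heis n) : Prop :=
  ContDiff ℝ 2 P ∧ P ξ = u ξ ∧
    (fun η => u η - P η) =o[nhds ξ] (fun η => ‖η - ξ‖ ^ 2)

/-- The `ε`-lower envelope `w_ε`. -/
def lowerEnv (Ω : Set (Heis n)) (w : Heis n → EReal) (ε : ℝ) (ξ : Heis n) : EReal :=
  ⨅ η ∈ closure Ω, (w η + (((1 / ε) * hnorm (hmul (hinv η) ξ) ^ 4 : ℝ) : EReal))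

/-- The `ε`-upper envelope `v^ε`. -/
def upperEnv (Ω : Set (Heis n)) (v : Heis n → EReal) (ε : ℝ) (ξ : Heis n) : EReal :=
  ⨆ η ∈ closure Ω, (v η - (((1 / ε) * hnorm (hmul (hinv η) ξ) ^ 4 : ℝ) : EReal))

/-- The `ε`-lower envelope, as a real valued function. -/
def lowerEnvR (Ω : Set (Heis n)) (w : Heis n → EReal) (ε : ℝ) (ξ : Heis n) : ℝ :=
  (lowerEnv Ω w ε ξ).toReal

/-- The `ε`-upper envelope, as a real valued function. -/
def upperEnvR (Ω : Set (Heis n)) (v : Heis n → EReal) (ε : ℝ) (ξ : Heis n) : ℝ :=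
  (upperEnv Ω v ε ξ).toReal

/-- The lower semicontinuous envelope `g_*` relative to `O`. -/
def lscEnv (O : Set (Heis n)) (g : Heis n → EReal) (ξ : Heis n) : EReal :=
  ⨆ (r : ℝ) (_ : 0 < r), ⨅ η ∈ O ∩ Metric.ball ξ r, g η

/-- The upper semicontinuous envelope `g^*` relative to `O`. -/
def uscEnv (O : Set (Heis n)) (g : Heis n → EReal) (ξ : Heis n) : EReal :=
  ⨅ (r : ℝ) (_ : 0 < r), ⨆ η ∈ O ∩ Metric.ball ξ r, g η

end Heis

open Heis

lemma aux_lip (f : ℝ → ℝ) (hf : LocallyLipschitz f) (R : ℝ) :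
    ∃ K : ℝ, 0 ≤ K ∧ ∀ s s' : ℝ, -R ≤ s → s ≤ s' → s' ≤ R → |f s' - f s| ≤ K * (s' - s) := by
  obtain ⟨K, hK⟩ := (hf.locallyLipschitzOn (s := Set.Icc (-R) R)).exists_lipschitzOnWith_of_compact
    isCompact_Icc
  refine ⟨K, K.2, fun s s' h1 h2 h3 => ?_⟩
  have := hK.dist_le_mul s' ⟨by linarith, h3⟩ s ⟨h1, by linarith⟩
  rwa [Real.dist_eq, Real.dist_eq, abs_of_nonneg (by linarith : 0 ≤ s' - s)] at this

lemma aux_J_inl {n : ℕ} (p : HIdx n → ℝ) (a : Fin n) :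
    (Jmat n *ᵥ p) (Sum.inl a) = p (Sum.inr a) := by
  simp [Matrix.mulVec, dotProduct, Jmat, Fintype.sum_sum_type]

lemma aux_J_inr {n : ℕ} (p : HIdx n → ℝ) (a : Fin n) :
    (Jmat n *ᵥ p) (Sum.inr a) = - p (Sum.inl a) := by
  simp [Matrix.mulVec, dotProduct, Jmat, Fintype.sum_sum_type]

lemma aux_J_sq {n : ℕ} (p : HIdx n → ℝ) :
    ∑ j, (Jmat n *ᵥ p) j ^ 2 = ∑ j, p j ^ 2 := by
  rw [Fintype.sum_sum_type, Fintype.sum_sum_type]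
  simp only [aux_J_inl, aux_J_inr, neg_sq]
  ring

lemma aux_pnorm_nonneg {n : ℕ} (p : HIdx n → ℝ) : 0 ≤ pnorm p := Real.sqrt_nonneg _

lemma aux_sum_nonneg {n : ℕ} (p : HIdx n → ℝ) : 0 ≤ ∑ j, p j ^ 2 :=
  Finset.sum_nonneg fun _ _ => sq_nonneg _

lemma aux_pnorm_sq {n : ℕ} (p : HIdx n → ℝ) : pnorm p ^ 2 = ∑ j, p j ^ 2 :=
  Real.sq_sqrt (aux_sum_nonneg p)

lemma aux_pnorm_rpow {n : ℕ} (p : HIdx n → ℝ) : pnorm p ^ (2 : ℝ) = ∑ j, p j ^ 2 := by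
  rw [← aux_pnorm_sq]; exact Real.rpow_two _

lemma aux_pnorm_J {n : ℕ} (p : HIdx n → ℝ) : pnorm (Jmat n *ᵥ p) = pnorm p := by
  unfold pnorm; rw [aux_J_sq]

lemma aux_coord {n : ℕ} (p : HIdx n → ℝ) (i : HIdx n) : |p i| ≤ pnorm p := by
  apply Real.abs_le_sqrt
  exact Finset.single_le_sum (f := fun j => p j ^ 2) (fun _ _ => sq_nonneg _) (Finset.mem_univ i)

lemma aux_pnorm_single {n : ℕ} (k : HIdx n) : pnorm (Pi.single k (1 : ℝ)) = 1 := by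
  unfold pnorm
  have : ∑ j, (Pi.single k (1 : ℝ) : HIdx n → ℝ) j ^ 2 = 1 := by
    rw [Finset.sum_eq_single k]
    · simp
    · intro b _ hb; simp [hb]
    · simp
  rw [this, Real.sqrt_one]

lemma aux_cs {n : ℕ} (p q : HIdx n → ℝ) : |∑ j, p j * q j| ≤ pnorm p * pnorm q := by
  unfold pnorm
  rw [← Real.sqrt_mul (aux_sum_nonneg p)]
  apply Real.abs_le_sqrt
  exact Finset.sum_mul_sq_le_sq_mul_sq _ _ _

lemma aux_psd {n : ℕ} (p : HIdx n → ℝ) : (vecMulVec p p : HMat n).PosSemidef := by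
  simpa using Matrix.posSemidef_vecMulVec_self_star p

lemma aux_psd' {n : ℕ} (p : HIdx n → ℝ) :
    ((∑ j, p j ^ 2) • (1 : HMat n) - vecMulVec p p).PosSemidef := by
  refine Matrix.PosSemidef.of_dotProduct_mulVec_nonneg ?_ ?_
  · exact (Matrix.PosSemidef.one.smul (aux_sum_nonneg p)).isHermitian.sub (aux_psd p).isHermitian
  · intro x
    have h : star x ⬝ᵥ (((∑ j, p j ^ 2) • (1 : HMat n) - vecMulVec p p) *ᵥ x)
        = (∑ j, p j ^ 2) * (∑ j, x j ^ 2) - (∑ j, p j * x j) ^ 2 := by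
      rw [Matrix.sub_mulVec, Matrix.smul_mulVec, Matrix.one_mulVec, Matrix.vecMulVec_mulVec,
        dotProduct_sub]
      simp only [star_trivial, dotProduct, smul_eq_mul, Pi.smul_apply,
        MulOpposite.smul_eq_mul_unop, MulOpposite.unop_op]
      congr 1
      · rw [Finset.mul_sum]
        apply Finset.sum_congr rfl
        intros; ring
      · rw [pow_two (∑ j, p j * x j), Finset.sum_mul]
        apply Finset.sum_congr rfl
        intros; ring
    rw [h]
    have := Finset.sum_mul_sq_le_sq_mul_sq Finset.univ p x
    linarith

/-- The bilinear form underlying `Lquad`. -/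
def auxB {n : ℕ} (a b c : ℝ) (p q : HIdx n → ℝ) (i j : HIdx n) : ℝ :=
  a * (p i * q j) - c * ((Jmat n *ᵥ p) i * (Jmat n *ᵥ q) j)
    - b * (∑ k, p k * q k) * (1 : HMat n) i j

lemma aux_B_bound {n : ℕ} (a b c : ℝ) (p q : HIdx n → ℝ) (i j : HIdx n) :
    |auxB a b c p q i j| ≤ (|a| + |b| + |c|) * (pnorm p * pnorm q) := by
  have h1 : |p i * q j| ≤ pnorm p * pnorm q := by
    rw [abs_mul]
    exact mul_le_mul (aux_coord _ _) (aux_coord _ _) (abs_nonneg _) (aux_pnorm_nonneg _)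
  have h2 : |(Jmat n *ᵥ p) i * (Jmat n *ᵥ q) j| ≤ pnorm p * pnorm q := by
    rw [abs_mul, ← aux_pnorm_J p, ← aux_pnorm_J q]
    exact mul_le_mul (aux_coord _ _) (aux_coord _ _) (abs_nonneg _) (aux_pnorm_nonneg _)
  have h3 : |(∑ k, p k * q k) * (1 : HMat n) i j| ≤ pnorm p * pnorm q := by
    rw [abs_mul]
    have : |(1 : HMat n) i j| ≤ 1 := by
      rw [Matrix.one_apply]; split_ifs <;> simp
    calc _ ≤ (pnorm p * pnorm q) * 1 := mul_le_mul (aux_cs p q) this (abs_nonneg _)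
            (mul_nonneg (aux_pnorm_nonneg _) (aux_pnorm_nonneg _))
      _ = _ := mul_one _
  have g1 := mul_le_mul_of_nonneg_left h1 (abs_nonneg a)
  have g2 := mul_le_mul_of_nonneg_left h2 (abs_nonneg c)
  have g3 := mul_le_mul_of_nonneg_left h3 (abs_nonneg b)
  rw [← abs_mul] at g1 g2 g3
  unfold auxB
  have t1 := abs_sub (a * (p i * q j) - c * ((Jmat n *ᵥ p) i * (Jmat n *ᵥ q) j))
    (b * (∑ k, p k * q k) * (1 : HMat n) i j)
  have t2 := abs_sub (a * (p i * q j)) (c * ((Jmat n *ᵥ p) i * (Jmat n *ᵥ q) j))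
  rw [mul_assoc b] at t1 ⊢
  linarith

lemma aux_L_eq {n : ℕ} (α β γ : ℝ → ℝ) (ξ : Heis n) (s : ℝ) (p : HIdx n → ℝ) (i j : HIdx n) :
    Lquad (fun _ s => α s) (fun _ s => β s) (fun _ s => γ s) ξ s p i j
      = auxB (α s) (β s) (γ s) p p i j := by
  simp [Lquad, auxB, vecMulVec_apply, pow_two]

lemma aux_B_expand {n : ℕ} (a b c : ℝ) (p v : HIdx n → ℝ) (t : ℝ) (i j : HIdx n) :
    auxB a b c (p + t • v) (p + t • v) i j = auxB a b c p p i j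
      + t * (auxB a b c p v i j + auxB a b c v p i j) + t ^ 2 * auxB a b c v v i j := by
  have h : ∑ k, (p + t • v) k * (p + t • v) k
      = ∑ k, p k * p k + t * (∑ k, p k * v k + ∑ k, v k * p k) + t ^ 2 * ∑ k, v k * v k := by
    simp only [Finset.mul_sum, ← Finset.sum_add_distrib]
    apply Finset.sum_congr rfl
    intros; simp; ring
  unfold auxB
  rw [h, Matrix.mulVec_add, Matrix.mulVec_smul]
  simp only [Pi.add_apply, Pi.smul_apply, smul_eq_mul]
  ring

lemma aux_fderiv {n : ℕ} (α β γ : ℝ → ℝ) (ξ : Heis n) (s : ℝ) (p v : HIdx n → ℝ) (i j : HIdx n)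
    (hd : DiffInP (Lquad (fun _ s => α s) (fun _ s => β s) (fun _ s => γ s)) ξ s p) :
    fderiv ℝ (fun q => Lquad (fun _ s => α s) (fun _ s => β s) (fun _ s => γ s) ξ s q i j) p v
      = auxB (α s) (β s) (γ s) p v i j + auxB (α s) (β s) (γ s) v p i j := by
  have h := (hd i j).hasFDerivAt.hasLineDerivAt v
  unfold HasLineDerivAt at h
  refine h.unique ?_
  simp only [aux_L_eq, aux_B_expand]
  have h1 := (((hasDerivAt_id (0 : ℝ)).mul_const
    (auxB (α s) (β s) (γ s) p v i j + auxB (α s) (β s) (γ s) v p i j)).const_add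
      (auxB (α s) (β s) (γ s) p p i j)).add
      (((hasDerivAt_id (0 : ℝ)).pow 2).mul_const (auxB (α s) (β s) (γ s) v v i j))
  convert h1 using 1
  · funext t
    simp
  · simp

lemma aux_pDot {n : ℕ} (α β γ : ℝ → ℝ) (ξ : Heis n) (s : ℝ) (p : HIdx n → ℝ)
    (hd : DiffInP (Lquad (fun _ s => α s) (fun _ s => β s) (fun _ s => γ s)) ξ s p) :
    pDotGradL (Lquad (fun _ s => α s) (fun _ s => β s) (fun _ s => γ s)) ξ s p
      = (2 : ℝ) • Lquad (fun _ s => α s) (fun _ s => β s) (fun _ s => γ s) ξ s p := by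
  ext i j
  rw [pDotGradL, Matrix.of_apply, aux_fderiv α β γ ξ s p p i j hd, Matrix.smul_apply, aux_L_eq,
    smul_eq_mul, two_mul]

lemma aux_gradBound {n : ℕ} (α β γ : ℝ → ℝ) (hαmono : Monotone α) (hβmono : Antitone β)
    (hγmono : Antitone γ) (R : ℝ) :
    ∃ K : ℝ, 0 < K ∧ ∀ (ξ : Heis n) (s : ℝ), |s| ≤ R → ∀ p : HIdx n → ℝ,
      DiffInP (Lquad (fun _ s => α s) (fun _ s => β s) (fun _ s => γ s)) ξ s p →
      pGradNorm (Lquad (fun _ s => α s) (fun _ s => β s) (fun _ s => γ s)) ξ s p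
        ≤ K * pnorm p := by
  set M : ℝ := (|α R| + |α (-R)|) + (|β R| + |β (-R)|) + (|γ R| + |γ (-R)|) with hM
  have hM0 : 0 ≤ M := by positivity
  set N : ℝ := (Fintype.card (HIdx n) : ℝ) with hN
  have hN0 : 0 ≤ N := by positivity
  refine ⟨Real.sqrt (N * (N * N)) * (2 * M) + 1, by positivity, fun ξ s hs p hd => ?_⟩
  obtain ⟨hs1, hs2⟩ := abs_le.1 hs
  have key : ∀ u v w : ℝ, u ≤ v → v ≤ w → |v| ≤ |u| + |w| := by
    intro u v w h1 h2
    rw [abs_le]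
    constructor
    · linarith [neg_abs_le u, abs_nonneg w]
    · linarith [le_abs_self w, abs_nonneg u]
  have b1 := key _ _ _ (hαmono hs1) (hαmono hs2)
  have b2 := key _ _ _ (hβmono hs2) (hβmono hs1)
  have b3 := key _ _ _ (hγmono hs2) (hγmono hs1)
  have hp := aux_pnorm_nonneg p
  have hbd : ∀ i j k : HIdx n, (fderiv ℝ (fun q => Lquad (fun _ s => α s) (fun _ s => β s)
      (fun _ s => γ s) ξ s q i j) p (Pi.single k 1)) ^ 2 ≤ (2 * M * pnorm p) ^ 2 := by
    intro i j k
    rw [aux_fderiv α β γ ξ s p _ i j hd]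
    apply sq_le_sq'
    all_goals
      have c1 := aux_B_bound (α s) (β s) (γ s) p (Pi.single k 1) i j
      have c2 := aux_B_bound (α s) (β s) (γ s) (Pi.single k 1) p i j
      rw [aux_pnorm_single] at c1 c2
      have c3 : (|α s| + |β s| + |γ s|) * pnorm p ≤ M * pnorm p :=
        mul_le_mul_of_nonneg_right (by linarith) hp
      have d1 := abs_le.1 c1
      have d2 := abs_le.1 c2
      rw [mul_one] at d1
      rw [one_mul] at d2
      linarith [d1.1, d1.2, d2.1, d2.2]
  have hsum : ∑ i : HIdx n, ∑ j : HIdx n, ∑ k : HIdx n,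
      (fderiv ℝ (fun q => Lquad (fun _ s => α s) (fun _ s => β s)
      (fun _ s => γ s) ξ s q i j) p (Pi.single k 1)) ^ 2
      ≤ (N * (N * N)) * (2 * M * pnorm p) ^ 2 := by
    calc _ ≤ ∑ i : HIdx n, ∑ j : HIdx n, ∑ k : HIdx n, (2 * M * pnorm p) ^ 2 :=
          Finset.sum_le_sum fun i _ => Finset.sum_le_sum fun j _ =>
            Finset.sum_le_sum fun k _ => hbd i j k
      _ = _ := by
          simp only [Finset.sum_const, Finset.card_univ, nsmul_eq_mul, ← hN]
          ring
  unfold pGradNorm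
  refine (Real.sqrt_le_sqrt hsum).trans ?_
  rw [Real.sqrt_mul (by positivity), Real.sqrt_sq (by positivity)]
  linarith

/-- Example 3.1: the quadratic `L` satisfies the structural conditions
(3.3), (3.4), (3.5) with `m = 2`. -/
theorem quadratic_L_satisfies_structural_conditions
    {n : ℕ} (hn : 1 ≤ n)
    (Ω : Set (Heis n)) (hΩopen : IsOpen Ω) (hΩbdd : Bornology.IsBounded Ω)
    (α β γ : ℝ → ℝ)
    (hα : LocallyLipschitz α) (hβ : LocallyLipschitz β) (hγ : LocallyLipschitz γ)
    (β₀ : ℝ) (hβ₀ : 0 < β₀) (hβpos : ∀ s, β₀ < β s)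
    (hγpos : ∀ s, 0 ≤ γ s)
    (hαmono : Monotone α) (hβmono : Antitone β) (hγmono : Antitone γ) :
    Cond33 Ω (Lquad (fun _ s => α s) (fun _ s => β s) (fun _ s => γ s)) 2 ∧
    Cond34 Ω (Lquad (fun _ s => α s) (fun _ s => β s) (fun _ s => γ s)) 2 ∧
    Cond35 Ω (Lquad (fun _ s => α s) (fun _ s => β s) (fun _ s => γ s)) 2 := by
  refine ⟨?_, ?_, ?_⟩
  · intro R hR
    obtain ⟨K, hK, hKb⟩ := aux_gradBound (n := n) α β γ hαmono hβmono hγmono R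
    refine ⟨K, hK, fun ξ _ s hs p => ⟨fun _ => ?_, fun hd => hKb ξ s hs p hd⟩⟩
    have h0 : xiGradNorm (Lquad (fun _ s => α s) (fun _ s => β s) (fun _ s => γ s)) ξ s p = 0 := by
      unfold xiGradNorm
      simp only [aux_L_eq]
      simp
    rw [h0, aux_pnorm_rpow]
    exact mul_nonneg hK.le (aux_sum_nonneg p)
  · intro R hR
    obtain ⟨Ka, hKa, ha⟩ := aux_lip α hα R
    obtain ⟨Kb, hKb, hb⟩ := aux_lip β hβ R
    obtain ⟨Kc, hKc, hc⟩ := aux_lip γ hγ R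
    refine ⟨Ka + Kb + Kc + 1, by positivity, fun ξ _ s s' h1 h2 h3 p => ?_⟩
    have a1 := (abs_le.1 (ha s s' h1 h2 h3)).2
    have b1 := (abs_le.1 (hb s s' h1 h2 h3)).1
    have c1 := (abs_le.1 (hc s s' h1 h2 h3)).1
    have a0 : 0 ≤ α s' - α s := sub_nonneg.2 (hαmono h2)
    have b0 : 0 ≤ β s - β s' := sub_nonneg.2 (hβmono h2)
    have c0 : 0 ≤ γ s - γ s' := sub_nonneg.2 (hγmono h2)
    have hS := aux_sum_nonneg p
    constructor
    · have h := (((aux_psd p).smul a0).add ((aux_psd (Jmat n *ᵥ p)).smul c0)).add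
        ((Matrix.PosSemidef.one (n := HIdx n) (R := ℝ)).smul (mul_nonneg b0 hS))
      unfold matLE
      convert h using 1
      unfold Lquad
      module
    · have hd : 0 ≤ (Ka + Kb + Kc + 1) * (s' - s) - (α s' - α s) - (β s - β s') - (γ s - γ s') := by
        nlinarith
      have h := (((aux_psd' p).smul a0).add ((aux_psd' (Jmat n *ᵥ p)).smul c0)).add
        ((Matrix.PosSemidef.one (n := HIdx n) (R := ℝ)).smul (mul_nonneg hd hS))
      unfold matLE
      convert h using 1
      rw [aux_pnorm_rpow, aux_J_sq]
      unfold Lquad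
      module
  · intro R hR Λ hΛ
    obtain ⟨K, hK, hKb⟩ := aux_gradBound (n := n) α β γ hαmono hβmono hγmono R
    refine ⟨2 * β₀ / (Λ * K) ^ 2, by positivity, |α R| + 2 / β₀, by positivity, ?_⟩
    intro θ hθ0 hθ ξ _ s hs p hd
    have hG := hKb ξ s hs p hd
    set G := pGradNorm (Lquad (fun _ s => α s) (fun _ s => β s) (fun _ s => γ s)) ξ s p
    set C := |α R| + 2 / β₀ with hC
    have hC0 : 0 < C := by positivity
    have hCα : 0 ≤ C - α s := by
      have := hαmono (abs_le.1 hs).2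
      have h2 : 0 < 2 / β₀ := by positivity
      linarith [le_abs_self (α R)]
    have hCinv : 1 / C ≤ β₀ / 2 := by
      rw [div_le_div_iff₀ hC0 two_pos]
      have : β₀ * C = β₀ * |α R| + 2 := by rw [hC]; field_simp
      rw [this]
      have : 0 ≤ β₀ * |α R| := by positivity
      linarith
    have hS := aux_sum_nonneg p
    have hp := aux_pnorm_nonneg p
    have hpsq := aux_pnorm_sq p
    have hθ' : θ * (Λ * K) ^ 2 ≤ 2 * β₀ := by
      rwa [le_div_iff₀ (by positivity)] at hθ
    have e1 : θ * Λ * G ≤ θ * (Λ * K * pnorm p) := by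
      rw [mul_assoc, mul_assoc Λ]
      gcongr
    have e2 : Λ * K * pnorm p ≤ 1 + (Λ * K * pnorm p) ^ 2 / 4 := by
      nlinarith [sq_nonneg (Λ * K * pnorm p / 2 - 1)]
    have e3 := mul_le_mul_of_nonneg_left e2 hθ0
    have e4 := mul_le_mul_of_nonneg_right hθ' hS
    have e5 : θ * (Λ * K * pnorm p) ^ 2 = θ * (Λ * K) ^ 2 * ∑ j, p j ^ 2 := by
      rw [← hpsq]; ring
    have e6 := mul_le_mul_of_nonneg_right hCinv hS
    have e7 := mul_le_mul_of_nonneg_right (hβpos s).le hS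
    have hI : 0 ≤ β s * ∑ j, p j ^ 2 - 1 / C * ∑ j, p j ^ 2 - θ * Λ * G + θ := by
      linarith
    have h := (((aux_psd p).smul hCα).add ((aux_psd (Jmat n *ᵥ p)).smul (hγpos s))).add
        ((Matrix.PosSemidef.one (n := HIdx n) (R := ℝ)).smul hI)
    unfold matLE
    rw [aux_pDot α β γ ξ s p hd, aux_pnorm_rpow]
    convert h using 1
    unfold Lquad
    module
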